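/- arXiv:2505.10346 — 4 statements merged into one kernel-verified Lean document; each statement's English description precedes it below -/
import Mathlib

section
/- For every ε > 0 there exist a real number a^ε > 0 and a sequence of points {x_k}_{k≥1} ⊂ ℝ³ such that, setting Q_k := Q(x_k, k^{−(1+ε)/3}) for each integer k ≥ 1, the cubes Q_n and Q_m are disjoint whenever n ≠ m, and every Q_k is contained in the box Q^ε := (0,1)×(0,1)×(0,a^ε). -/
noncomputable section

/-- Points of `ℝ³`. -/
abbrev R3 : Type := Fin 3 → ℝ

/-- The open cube `Q(x,ℓ)` of side `ℓ > 0` with corner `x`. -/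
def cube (x : R3) (ℓ : ℝ) : Set R3 := Set.univ.pi fun i => Set.Ioo (x i) (x i + ℓ)

/-- The open box `(0,1) × (0,1) × (0,a)`. -/
def box (a : ℝ) : Set R3 := Set.univ.pi fun i => Set.Ioo 0 (if (i : ℕ) = 2 then a else 1)

theorem cube_inter_eq_empty {x y : R3} {ℓ ℓ' : ℝ} (i : Fin 3)
    (h : x i + ℓ ≤ y i ∨ y i + ℓ' ≤ x i) : cube x ℓ ∩ cube y ℓ' = ∅ := by
  ext p
  simp only [cube, Set.mem_inter_iff, Set.mem_univ_pi, Set.mem_Ioo, Set.mem_empty_iff_false,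
    iff_false, not_and]
  intro hx hy
  have := hx i
  have := hy i
  rcases h with h | h <;> linarith

theorem cube_subset_box {x : R3} {ℓ a : ℝ} (h0 : ∀ i, 0 ≤ x i) (hx : x 0 + ℓ ≤ 1)
    (hy : x 1 + ℓ ≤ 1) (hz : x 2 + ℓ ≤ a) : cube x ℓ ⊆ box a := by
  intro p hp
  simp only [cube, box, Set.mem_univ_pi, Set.mem_Ioo] at hp ⊢
  intro i
  refine ⟨(h0 i).trans_lt (hp i).1, (hp i).2.trans_le ?_⟩
  fin_cases i <;> simpa

/-- Two distinct cells `d * [u, u + 1]` and `d * [v, v + 1]` of a grid do not overlap. -/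
theorem grid_cells_separated {d ℓ ℓ' c : ℝ} {u v : ℕ} (hd : 0 ≤ d) (hℓ : ℓ ≤ d) (hℓ' : ℓ' ≤ d)
    (h : u ≠ v) : c + d * u + ℓ ≤ c + d * v ∨ c + d * v + ℓ' ≤ c + d * u := by
  rcases lt_or_gt_of_ne h with h | h
  · left
    have h' : (u : ℝ) + 1 ≤ v := by exact_mod_cast h
    nlinarith
  · right
    have h' : (v : ℝ) + 1 ≤ u := by exact_mod_cast h
    nlinarith

/-- The corner of the cell with index `k` in a grid of mesh `2⁻ʲ` filling
`[0,1] × [0,1] × [z, ∞)` layer by layer. -/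
def gridCorner (z : ℝ) (j k : ℕ) : R3 :=
  ![0 + (1 / 2) ^ j * ((k % 2 ^ j : ℕ) : ℝ), 0 + (1 / 2) ^ j * ((k / 2 ^ j % 2 ^ j : ℕ) : ℝ),
    z + (1 / 2) ^ j * ((k / 2 ^ j / 2 ^ j : ℕ) : ℝ)]

theorem cube_gridCorner_inter_eq_empty {z ℓ ℓ' : ℝ} {j n m : ℕ} (hℓ : ℓ ≤ (1 / 2) ^ j)
    (hℓ' : ℓ' ≤ (1 / 2) ^ j) (h : n ≠ m) :
    cube (gridCorner z j n) ℓ ∩ cube (gridCorner z j m) ℓ' = ∅ := by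
  have hd : (0 : ℝ) ≤ (1 / 2) ^ j := by positivity
  by_cases h0 : n % 2 ^ j = m % 2 ^ j
  · by_cases h1 : n / 2 ^ j % 2 ^ j = m / 2 ^ j % 2 ^ j
    · by_cases h2 : n / 2 ^ j / 2 ^ j = m / 2 ^ j / 2 ^ j
      · have h3 : n / 2 ^ j = m / 2 ^ j := by
          rw [← Nat.div_add_mod (n / 2 ^ j) (2 ^ j), h1, h2, Nat.div_add_mod]
        exact absurd (by rw [← Nat.div_add_mod n (2 ^ j), h0, h3, Nat.div_add_mod]) h
      · exact cube_inter_eq_empty 2 (grid_cells_separated hd hℓ hℓ' h2)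
    · exact cube_inter_eq_empty 1 (grid_cells_separated hd hℓ hℓ' h1)
  · exact cube_inter_eq_empty 0 (grid_cells_separated hd hℓ hℓ' h0)

theorem half_pow_mul_mod_add_le (j k : ℕ) :
    0 + (1 / 2 : ℝ) ^ j * ((k % 2 ^ j : ℕ) : ℝ) + (1 / 2) ^ j ≤ 1 := by
  have h : ((k % 2 ^ j : ℕ) : ℝ) + 1 ≤ 2 ^ j := by
    exact_mod_cast Nat.mod_lt k (by positivity)
  calc 0 + (1 / 2 : ℝ) ^ j * ((k % 2 ^ j : ℕ) : ℝ) + (1 / 2) ^ j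
      = (1 / 2) ^ j * (((k % 2 ^ j : ℕ) : ℝ) + 1) := by ring
    _ ≤ (1 / 2) ^ j * 2 ^ j := by gcongr
    _ = 1 := by rw [← mul_pow]; norm_num

theorem gridCorner_top_le {z b : ℝ} {j k : ℕ} (hk : (k : ℝ) ≤ b ^ (j + 1)) :
    gridCorner z j k 2 + (1 / 2) ^ j ≤ z + (b * (b / 8) ^ j + (1 / 2) ^ j) := by
  have h : ((k / 2 ^ j / 2 ^ j : ℕ) : ℝ) ≤ k / 4 ^ j := by
    rw [Nat.div_div_eq_div_mul, ← mul_pow]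
    exact_mod_cast Nat.cast_div_le (α := ℝ) (m := k) (n := (2 * 2) ^ j)
  have h' : (1 / 2 : ℝ) ^ j * ((k / 2 ^ j / 2 ^ j : ℕ) : ℝ) ≤ b * (b / 8) ^ j :=
    calc (1 / 2 : ℝ) ^ j * ((k / 2 ^ j / 2 ^ j : ℕ) : ℝ)
        ≤ (1 / 2) ^ j * (b ^ (j + 1) / 4 ^ j) := by
          gcongr
          exact h.trans (by gcongr)
      _ = b * (b / 8) ^ j := by
          rw [show (8 : ℝ) = 2 * 4 by norm_num, div_pow, div_pow, mul_pow, one_pow]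
          field_simp
          ring
  change z + (1 / 2 : ℝ) ^ j * ((k / 2 ^ j / 2 ^ j : ℕ) : ℝ) + (1 / 2) ^ j ≤ _
  linarith

/-- The dyadic scale of `k ^ (-s)`, and the resulting bound on `k`. -/
theorem exists_dyadic_scale {s : ℝ} (hs : 0 < s) {k : ℕ} (hk : 1 ≤ k) :
    ∃ j : ℕ, (k : ℝ) ^ (-s) ≤ (1 / 2) ^ j ∧ (k : ℝ) ≤ ((2 : ℝ) ^ s⁻¹) ^ (j + 1) := by
  have hk' : (1 : ℝ) ≤ k := by exact_mod_cast hk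
  obtain ⟨j, hj, hj'⟩ := exists_nat_pow_near (Real.one_le_rpow hk' hs.le) one_lt_two
  refine ⟨j, ?_, ?_⟩
  · rw [Real.rpow_neg (by positivity), one_div, inv_pow]
    gcongr
  · calc (k : ℝ) = ((k : ℝ) ^ s) ^ s⁻¹ := (Real.rpow_rpow_inv (by positivity) hs.ne').symm
      _ ≤ ((2 : ℝ) ^ (j + 1)) ^ s⁻¹ := by gcongr
      _ = ((2 : ℝ) ^ s⁻¹) ^ (j + 1) := (Real.rpow_pow_comm (by norm_num) _ _).symm

/-- Cube packing.
For every `ε > 0` there are `aε > 0` and corners `{x_k}_{k ≥ 1} ⊂ ℝ³` such that the cubes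
`Q_k := Q(x_k, k^{−(1+ε)/3})` are pairwise disjoint and all contained in the box
`Qε := (0,1) × (0,1) × (0,aε)`. -/
theorem cube_packing (ε : ℝ) (hε : 0 < ε) :
    ∃ (aε : ℝ) (x : ℕ → R3), 0 < aε ∧
      (∀ n m : ℕ, 1 ≤ n → 1 ≤ m → n ≠ m →
        cube (x n) ((n : ℝ) ^ (-(1 + ε) / 3)) ∩ cube (x m) ((m : ℝ) ^ (-(1 + ε) / 3)) = ∅) ∧
      (∀ k : ℕ, 1 ≤ k → cube (x k) ((k : ℝ) ^ (-(1 + ε) / 3)) ⊆ box aε) := by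
  have hs : 0 < (1 + ε) / 3 := by positivity
  set s := (1 + ε) / 3 with hs_def
  have hexp : -(1 + ε) / 3 = -s := by rw [hs_def]; ring
  rw [hexp]
  choose! j hℓ hk using fun (k : ℕ) (hk : 1 ≤ k) => exists_dyadic_scale hs hk
  set b : ℝ := 2 ^ s⁻¹
  have hb : 0 < b := by positivity
  have hb8 : b < 8 := by
    have h3 : s⁻¹ < 3 := by
      rw [inv_lt_comm₀ hs (by norm_num), hs_def]
      linarith
    calc b < (2 : ℝ) ^ (3 : ℝ) := Real.rpow_lt_rpow_of_exponent_lt one_lt_two h3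
      _ = 8 := by norm_num
  set H : ℕ → ℝ := fun i => b * (b / 8) ^ i + (1 / 2) ^ i
  have hH_pos : ∀ i, 0 < H i := fun i => by positivity
  have hH_sum : Summable H :=
    ((summable_geometric_of_lt_one (by positivity) (by linarith)).mul_left b).add
      summable_geometric_two
  set z : ℕ → ℝ := fun i => ∑ l ∈ Finset.range i, H l
  have hz_succ : ∀ i, z (i + 1) = z i + H i := fun i => Finset.sum_range_succ H i
  have hz_mono : Monotone z := monotone_nat_of_le_succ fun i => by
    linarith [hz_succ i, hH_pos i]
  have hz_nonneg : ∀ i, 0 ≤ z i := fun i => Finset.sum_nonneg fun l _ => (hH_pos l).le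
  have htop : ∀ k : ℕ, 1 ≤ k →
      gridCorner (z (j k)) (j k) k 2 + (k : ℝ) ^ (-s) ≤ z (j k + 1) := fun k h1 => by
    have := gridCorner_top_le (z := z (j k)) (hk k h1)
    linarith [hz_succ (j k), hℓ k h1]
  have hbot : ∀ k, z (j k) ≤ gridCorner (z (j k)) (j k) k 2 := fun k =>
    le_add_of_nonneg_right (by positivity)
  refine ⟨∑' i, H i, fun k => gridCorner (z (j k)) (j k) k,
    hH_sum.tsum_pos (fun i => (hH_pos i).le) 0 (hH_pos 0), ?_, ?_⟩
  · intro n m hn hm hnm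
    rcases lt_trichotomy (j n) (j m) with h | h | h
    · exact cube_inter_eq_empty 2 (.inl ((htop n hn).trans ((hz_mono h).trans (hbot m))))
    · have hℓm := hℓ m hm
      rw [← h] at hℓm
      simp only [← h]
      exact cube_gridCorner_inter_eq_empty (hℓ n hn) hℓm hnm
    · exact cube_inter_eq_empty 2 (.inr ((htop m hm).trans ((hz_mono h).trans (hbot n))))
  · intro k h1
    refine cube_subset_box (fun i => ?_) ?_ ?_ ?_
    · fin_cases i
      · change 0 ≤ 0 + (1 / 2 : ℝ) ^ j k * _
        positivity
      · change 0 ≤ 0 + (1 / 2 : ℝ) ^ j k * _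
        positivity
      · exact (hz_nonneg _).trans (hbot k)
    · exact (add_le_add_right (hℓ k h1) _).trans (half_pow_mul_mod_add_le (j k) k)
    · exact (add_le_add_right (hℓ k h1) _).trans (half_pow_mul_mod_add_le (j k) (k / 2 ^ j k))
    · exact (htop k h1).trans (hH_sum.sum_le_tsum _ fun l _ => (hH_pos l).le)
end
end

section
/- Let 0 < s < 1 and p ≥ 2 satisfy sp ≥ 3ε/(1+ε), and suppose the Gagliardo seminorm ĉ := |Â|_{W^{s,p}(Q̂)}^p is strictly positive (e.g. because Â is continuous and nonconstant on Q̂). Then |A^ε|_{W^{s,p}(Q^ε)}^p = +∞ for any open set Q^ε containing all the cubes Q_k; in particular A^ε ∉ W^{s,p}(Q^ε). -/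
noncomputable section

open MeasureTheory Matrix

/-- Real `3×3` matrices. -/
abbrev Mat3 : Type := Matrix (Fin 3) (Fin 3) ℝ

/-- Euclidean norm of a vector of `ℝ³`. -/
def enorm3 (v : Fin 3 → ℝ) : ℝ := Real.sqrt (∑ i, v i ^ 2)

/-- A matrix norm (the Frobenius norm). -/
def matNorm (A : Mat3) : ℝ := Real.sqrt (∑ i, ∑ j, A i j ^ 2)

/-- The reference (open) unit cube `Q̂ = Q(0,1)`. -/
def unitCube : Set R3 := cube 0 1

/-- The inverse affine map `F_k⁻¹(x) = k^{(1+ε)/3}(x − x_k)`. -/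
def FmapInv (ε : ℝ) (xc : ℕ → R3) (k : ℕ) (x : R3) : R3 := ((k : ℝ) ^ ((1 + ε) / 3)) • (x - xc k)

/-- The (p-th power of the) Gagliardo seminorm
`|A|_{W^{s,p}(U)}^p = ∫_U ∫_U |A(x)−A(y)|^p / |x−y|^{sp+3} dx dy`, valued in `[0,∞]`. -/
def gagliardo (A : R3 → Mat3) (s p : ℝ) (U : Set R3) : ENNReal :=
  ∫⁻ x in U, ∫⁻ y in U,
    ENNReal.ofReal (matNorm (A x - A y) ^ p / enorm3 (x - y) ^ (s * p + 3))

lemma cube_eq_image (c : R3) {l : ℝ} (hl : 0 < l) :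
    cube c l = (fun x : R3 => c + l • x) '' unitCube := by
  ext x
  simp only [unitCube, cube, Set.mem_image, Set.mem_pi, Set.mem_univ, true_implies, Set.mem_Ioo,
    Pi.zero_apply, zero_add]
  constructor
  · intro h
    refine ⟨l⁻¹ • (x - c), fun i => ⟨?_, ?_⟩, ?_⟩
    · have := (h i).1
      simp only [Pi.smul_apply, Pi.sub_apply, smul_eq_mul]
      exact mul_pos (inv_pos.2 hl) (sub_pos.2 this)
    · have := (h i).2
      simp only [Pi.smul_apply, Pi.sub_apply, smul_eq_mul]
      rw [inv_mul_lt_iff₀ hl]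
      linarith
    · rw [smul_smul, mul_inv_cancel₀ hl.ne', one_smul, add_sub_cancel]
  · rintro ⟨y, hy, rfl⟩ i
    obtain ⟨h0, h1⟩ := hy i
    simp only [Pi.add_apply, Pi.smul_apply, smul_eq_mul]
    exact ⟨by nlinarith, by nlinarith⟩

lemma measurableSet_cube (c : R3) (l : ℝ) : MeasurableSet (cube c l) :=
  MeasurableSet.univ_pi fun _ => measurableSet_Ioo

lemma measurableSet_unitCube : MeasurableSet unitCube :=
  measurableSet_cube 0 1

/-- Change of variables from a cube to the unit cube; no measurability of `g` is needed. -/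
lemma lintegral_cube (c : R3) {l : ℝ} (hl : 0 < l) (g : R3 → ENNReal) :
    ∫⁻ x in cube c l, g x = ENNReal.ofReal (l ^ 3) * ∫⁻ x in unitCube, g (c + l • x) := by
  have hderiv : ∀ x ∈ unitCube, HasFDerivWithinAt (fun x : R3 => c + l • x)
      (l • ContinuousLinearMap.id ℝ R3) unitCube x := fun x _ =>
    (((hasFDerivAt_id x).const_smul l).const_add c).hasFDerivWithinAt
  have hinj : Set.InjOn (fun x : R3 => c + l • x) unitCube := fun x _ y _ h =>
    smul_right_injective R3 hl.ne' (add_left_cancel h)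
  have hdet : |(l • ContinuousLinearMap.id ℝ R3).det| = l ^ 3 := by
    have h : (l • ContinuousLinearMap.id ℝ R3).det = l ^ 3 := by
      simp [ContinuousLinearMap.det]
    rw [h, abs_of_pos (pow_pos hl 3)]
  rw [cube_eq_image c hl, lintegral_image_eq_lintegral_abs_det_fderiv_mul volume
    measurableSet_unitCube hderiv hinj, hdet, lintegral_const_mul' _ _ ENNReal.ofReal_ne_top]

lemma enorm3_nonneg (v : R3) : 0 ≤ enorm3 v :=
  Real.sqrt_nonneg _

lemma enorm3_smul {l : ℝ} (hl : 0 ≤ l) (v : R3) : enorm3 (l • v) = l * enorm3 v := by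
  simp only [enorm3, Pi.smul_apply, smul_eq_mul, mul_pow, ← Finset.mul_sum]
  rw [Real.sqrt_mul (sq_nonneg l), Real.sqrt_sq hl]

/-- Scaling of the Gagliardo seminorm under an affine map onto a cube of side `l`. -/
lemma gagliardo_cube {A B : R3 → Mat3} {c : R3} {l : ℝ} (hl : 0 < l)
    (hAB : ∀ x ∈ unitCube, A (c + l • x) = B x) (s p : ℝ) :
    gagliardo A s p (cube c l) = ENNReal.ofReal (l ^ (3 - s * p)) * gagliardo B s p unitCube := by
  have hker : ∀ x ∈ unitCube, ∀ y ∈ unitCube,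
      ENNReal.ofReal (matNorm (A (c + l • x) - A (c + l • y)) ^ p /
        enorm3 (c + l • x - (c + l • y)) ^ (s * p + 3)) =
      ENNReal.ofReal (l ^ (-(s * p + 3))) *
        ENNReal.ofReal (matNorm (B x - B y) ^ p / enorm3 (x - y) ^ (s * p + 3)) := by
    intro x hx y hy
    rw [← ENNReal.ofReal_mul (Real.rpow_nonneg hl.le _), hAB x hx, hAB y hy,
      add_sub_add_left_eq_sub, ← smul_sub, enorm3_smul hl.le,
      Real.mul_rpow hl.le (enorm3_nonneg _), Real.rpow_neg hl.le]
    congr 1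
    rw [div_mul_eq_div_div_swap, div_eq_inv_mul]
  have hinner : ∀ x ∈ unitCube,
      ∫⁻ y in cube c l, ENNReal.ofReal (matNorm (A (c + l • x) - A y) ^ p /
        enorm3 (c + l • x - y) ^ (s * p + 3)) =
      (ENNReal.ofReal (l ^ 3) * ENNReal.ofReal (l ^ (-(s * p + 3)))) * ∫⁻ y in unitCube,
        ENNReal.ofReal (matNorm (B x - B y) ^ p / enorm3 (x - y) ^ (s * p + 3)) := by
    intro x hx
    rw [lintegral_cube c hl, setLIntegral_congr_fun measurableSet_unitCube (hker x hx),
      lintegral_const_mul' _ _ ENNReal.ofReal_ne_top, mul_assoc]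
  have hpow : ENNReal.ofReal (l ^ 3) * (ENNReal.ofReal (l ^ 3) *
      ENNReal.ofReal (l ^ (-(s * p + 3)))) = ENNReal.ofReal (l ^ (3 - s * p)) := by
    rw [← ENNReal.ofReal_mul (by positivity), ← ENNReal.ofReal_mul (by positivity),
      ← Real.rpow_natCast, ← Real.rpow_add hl, ← Real.rpow_add hl]
    congr 2
    push_cast
    ring
  rw [gagliardo, lintegral_cube c hl, setLIntegral_congr_fun measurableSet_unitCube hinner,
    lintegral_const_mul' _ _ (ENNReal.mul_ne_top ENNReal.ofReal_ne_top ENNReal.ofReal_ne_top),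
    ← mul_assoc, hpow, gagliardo]

/-- The Gagliardo seminorm is superadditive over disjoint measurable subsets. -/
lemma tsum_gagliardo_le (A : R3 → Mat3) (s p : ℝ) {Q : ℕ → Set R3} {U : Set R3}
    (hQ : ∀ k, MeasurableSet (Q k)) (hdisj : Pairwise (Function.onFun Disjoint Q))
    (hQU : ∀ k, Q k ⊆ U) : ∑' k, gagliardo A s p (Q k) ≤ gagliardo A s p U :=
  calc ∑' k, gagliardo A s p (Q k)
      ≤ ∑' k, ∫⁻ x in Q k, ∫⁻ y in U,
          ENNReal.ofReal (matNorm (A x - A y) ^ p / enorm3 (x - y) ^ (s * p + 3)) :=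
        ENNReal.tsum_le_tsum fun k => lintegral_mono fun _ => lintegral_mono_set (hQU k)
    _ = ∫⁻ x in ⋃ k, Q k, ∫⁻ y in U,
          ENNReal.ofReal (matNorm (A x - A y) ^ p / enorm3 (x - y) ^ (s * p + 3)) :=
        (lintegral_iUnion hQ hdisj _).symm
    _ ≤ gagliardo A s p U := by
        rw [gagliardo]
        exact lintegral_mono_set (Set.iUnion_subset hQU)

lemma tsum_ofReal_harmonic :
    ∑' k : ℕ, ENNReal.ofReal (((k + 1 : ℕ) : ℝ)⁻¹) = ⊤ := by
  by_contra h
  have hs := ENNReal.summable_toReal h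
  simp only [ENNReal.toReal_ofReal (inv_nonneg.2 (Nat.cast_nonneg _))] at hs
  exact Real.not_summable_natCast_inv
    ((summable_nat_add_iff (f := fun n : ℕ => (n : ℝ)⁻¹) 1).1 hs)

/-- Let `0 < s < 1` and `p ≥ 2` with `sp ≥ 3ε/(1+ε)`, and suppose the Gagliardo seminorm
`ĉ := |Â|_{W^{s,p}(Q̂)}^p` is strictly positive.  Then `|Aε|_{W^{s,p}(Qε)}^p = +∞` for any
open set `Qε` containing all the cubes `Q_k`; in particular `Aε ∉ W^{s,p}(Qε)`. -/
theorem coefficient_not_sobolev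
    (ε : ℝ) (hε : 0 < ε) (xc : ℕ → R3)
    (hdisj : ∀ n m : ℕ, 1 ≤ n → 1 ≤ m → n ≠ m →
      cube (xc n) ((n : ℝ) ^ (-(1 + ε) / 3)) ∩ cube (xc m) ((m : ℝ) ^ (-(1 + ε) / 3)) = ∅)
    (Ahat : R3 → Mat3) (hAhat_meas : ∀ i j : Fin 3, Measurable fun x => Ahat x i j)
    (Aeps : R3 → Mat3)
    (hin : ∀ k : ℕ, 1 ≤ k → ∀ x ∈ cube (xc k) ((k : ℝ) ^ (-(1 + ε) / 3)),
      Aeps x = Ahat (FmapInv ε xc k x))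
    (hout : ∀ x : R3, (∀ k : ℕ, 1 ≤ k → x ∉ cube (xc k) ((k : ℝ) ^ (-(1 + ε) / 3))) →
      Aeps x = 1)
    (s p : ℝ) (hs0 : 0 < s) (hs1 : s < 1) (hp : 2 ≤ p)
    (hsp : 3 * ε / (1 + ε) ≤ s * p)
    (hchat : 0 < gagliardo Ahat s p unitCube) :
    ∀ U : Set R3, IsOpen U →
      (∀ k : ℕ, 1 ≤ k → cube (xc k) ((k : ℝ) ^ (-(1 + ε) / 3)) ⊆ U) →
      gagliardo Aeps s p U = ⊤ := by
  intro U _ hU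
  have hk : ∀ k : ℕ, (0 : ℝ) < ((k + 1 : ℕ) : ℝ) := fun k => Nat.cast_pos.2 k.succ_pos
  have hterm : ∀ k : ℕ, ENNReal.ofReal (((k + 1 : ℕ) : ℝ)⁻¹) * gagliardo Ahat s p unitCube ≤
      gagliardo Aeps s p (cube (xc (k + 1)) (((k + 1 : ℕ) : ℝ) ^ (-(1 + ε) / 3))) := by
    intro k
    have hl := Real.rpow_pos_of_pos (hk k) (-(1 + ε) / 3)
    rw [gagliardo_cube (B := Ahat) hl]
    · gcongr
      rw [← Real.rpow_mul (hk k).le, ← Real.rpow_neg_one]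
      refine Real.rpow_le_rpow_of_exponent_le (by exact_mod_cast k.succ_pos) ?_
      rw [div_le_iff₀ (by linarith)] at hsp
      linarith
    · intro x hx
      rw [hin (k + 1) k.succ_pos _ (by rw [cube_eq_image _ hl]; exact ⟨x, hx, rfl⟩), FmapInv,
        add_sub_cancel_left, smul_smul, ← Real.rpow_add (hk k)]
      rw [neg_div, add_neg_cancel, Real.rpow_zero, one_smul]
  refine top_le_iff.1 ?_
  calc (⊤ : ENNReal)
      = (∑' k : ℕ, ENNReal.ofReal (((k + 1 : ℕ) : ℝ)⁻¹)) * gagliardo Ahat s p unitCube := by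
        rw [tsum_ofReal_harmonic, ENNReal.top_mul hchat.ne']
    _ = ∑' k : ℕ, ENNReal.ofReal (((k + 1 : ℕ) : ℝ)⁻¹) * gagliardo Ahat s p unitCube :=
        ENNReal.tsum_mul_right.symm
    _ ≤ ∑' k : ℕ,
          gagliardo Aeps s p (cube (xc (k + 1)) (((k + 1 : ℕ) : ℝ) ^ (-(1 + ε) / 3))) :=
        ENNReal.tsum_le_tsum hterm
    _ ≤ gagliardo Aeps s p U :=
        tsum_gagliardo_le Aeps s p (fun _ => measurableSet_cube _ _)
          (fun n m hnm => Set.disjoint_iff_inter_eq_empty.2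
            (hdisj (n + 1) (m + 1) n.succ_pos m.succ_pos (by simpa using hnm)))
          fun k => hU (k + 1) k.succ_pos
end
end

section
/- Fix 0 < α < 1, ρ > 0 and 0 < η < 1. There exists μ⋆ = μ⋆(α,ρ,η) > 0 with the following property: for every integer k⋆ and every sequence {x_k}_{k≥k⋆} of positive reals satisfying x_{k+1} ≥ x_k + ρ x_k^α for all k ≥ k⋆ and x_{k⋆} ≥ μ⋆, one has x_k ≥ ((1−α)(1−η)ρ(k−k⋆) + x_{k⋆}^{1−α})^{1/(1−α)} for all k ≥ k⋆. -/
/-- A reverse Bernoulli inequality for small increments. -/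
theorem one_add_mul_le_one_add_rpow {b η u : ℝ} (hb0 : 0 < b) (hb1 : b ≤ 1)
    (hη1 : η < 1) (hu0 : 0 ≤ u) (huη : u ≤ η) :
    1 + b * (1 - η) * u ≤ (1 + u) ^ b := by
  have hpos : 0 < 1 + u := by linarith
  have hpow : 0 < (1 + u) ^ b := Real.rpow_pos_of_pos hpos b
  have hinv : 1 + -(u / (1 + u)) = (1 + u)⁻¹ := by field_simp; ring
  have hlt : u / (1 + u) ≤ 1 := by rw [div_le_one hpos]; linarith
  have hbern := rpow_one_add_le_one_add_mul_self (s := -(u / (1 + u)))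
    (by linarith) hb0.le hb1
  rw [hinv, Real.inv_rpow hpos.le] at hbern
  have hfrac : (1 - η) * u ≤ u / (1 + u) := by
    rw [le_div_iff₀ hpos]
    nlinarith [mul_nonneg hu0 (sub_nonneg.mpr huη), mul_nonneg hu0 (mul_nonneg hu0 (hu0.trans huη))]
  have hle : ((1 + u) ^ b)⁻¹ ≤ 1 - b * (1 - η) * u := by
    nlinarith [mul_le_mul_of_nonneg_left hfrac hb0.le]
  have hmul : 1 ≤ (1 - b * (1 - η) * u) * (1 + u) ^ b := by
    simpa [hpow.ne'] using mul_le_mul_of_nonneg_right hle hpow.le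
  have ht : 0 ≤ b * (1 - η) * u := by
    have : 0 ≤ 1 - η := by linarith
    positivity
  nlinarith [mul_le_mul_of_nonneg_left hmul (by linarith : 0 ≤ 1 + b * (1 - η) * u),
    mul_nonneg (sq_nonneg (b * (1 - η) * u)) hpow.le]

/-- One step of the recurrence `x ↦ x + ρ x^α` raises `x^(1-α)` by at least
`(1-α)(1-η)ρ` once `x^(1-α) ≥ ρ/η`. -/
theorem rpow_add_le_rpow_add_mul_rpow {α ρ η x : ℝ} (hα0 : 0 < α) (hα1 : α < 1) (hρ : 0 < ρ)
    (hη0 : 0 < η) (hη1 : η < 1) (hx : 0 < x) (hlarge : ρ / η ≤ x ^ (1 - α)) :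
    (1 - α) * (1 - η) * ρ + x ^ (1 - α) ≤ (x + ρ * x ^ α) ^ (1 - α) := by
  have hy : 0 < x ^ (1 - α) := Real.rpow_pos_of_pos hx _
  have hsplit : x ^ α * x ^ (1 - α) = x := by
    rw [← Real.rpow_add hx]; simp
  have hu : 0 ≤ ρ / x ^ (1 - α) := by positivity
  have hfactor : x + ρ * x ^ α = x * (1 + ρ / x ^ (1 - α)) := by
    have : x * (ρ / x ^ (1 - α)) = ρ * x ^ α := by
      rw [mul_div_assoc', div_eq_iff hy.ne', mul_assoc, hsplit, mul_comm]
    rw [mul_add, this, mul_one]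
  have hsmall : ρ / x ^ (1 - α) ≤ η := by
    rw [div_le_iff₀ hη0] at hlarge
    rw [div_le_iff₀ hy]; linarith
  have h := mul_le_mul_of_nonneg_left
    (one_add_mul_le_one_add_rpow (b := 1 - α) (by linarith) (by linarith) hη1 hu hsmall) hy.le
  rw [hfactor, Real.mul_rpow hx.le (by linarith)]
  refine le_trans (le_of_eq ?_) h
  field_simp
  ring

/-- Recurrent sequence lower bound.
Fix `0 < α < 1`, `ρ > 0`, `0 < η < 1`.  There is `μ⋆ = μ⋆(α,ρ,η) > 0` such that any sequence
of positive reals with `x_{k+1} ≥ x_k + ρ x_k^α` for `k ≥ kst` and `x_{kst} ≥ μ⋆` satisfies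
`x_k ≥ ((1−α)(1−η)ρ(k−kst) + x_{kst}^{1−α})^{1/(1−α)}` for all `k ≥ kst`. -/
theorem recurrent_sequence_bound (α ρ η : ℝ) (hα0 : 0 < α) (hα1 : α < 1) (hρ : 0 < ρ)
    (hη0 : 0 < η) (hη1 : η < 1) :
    ∃ μ : ℝ, 0 < μ ∧
      ∀ (kst : ℕ) (x : ℕ → ℝ),
        (∀ k : ℕ, kst ≤ k → 0 < x k) →
        (∀ k : ℕ, kst ≤ k → x k + ρ * x k ^ α ≤ x (k + 1)) →
        μ ≤ x kst →
        ∀ k : ℕ, kst ≤ k →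
          ((1 - α) * (1 - η) * ρ * ((k : ℝ) - (kst : ℝ)) + x kst ^ (1 - α)) ^ (1 / (1 - α))
            ≤ x k := by
  have hb : 0 < 1 - α := by linarith
  have hc : 0 ≤ (1 - α) * (1 - η) * ρ := by
    have : 0 < 1 - η := by linarith
    positivity
  refine ⟨(ρ / η) ^ (1 / (1 - α)), by positivity, fun kst x hx hrec hμ k hk => ?_⟩
  have hstart : ρ / η ≤ x kst ^ (1 - α) := by
    have h := Real.rpow_le_rpow (by positivity) hμ hb.le
    rwa [← Real.rpow_mul (by positivity), one_div_mul_cancel hb.ne', Real.rpow_one] at h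
  have hmain : (1 - α) * (1 - η) * ρ * ((k : ℝ) - (kst : ℝ)) + x kst ^ (1 - α)
      ≤ x k ^ (1 - α) := by
    induction k, hk using Nat.le_induction with
    | base => simp
    | succ k hk ih =>
      have hdiff : (0 : ℝ) ≤ (k : ℝ) - (kst : ℝ) := sub_nonneg.mpr (by exact_mod_cast hk)
      have hlarge : ρ / η ≤ x k ^ (1 - α) := by linarith [mul_nonneg hc hdiff]
      have hstep := rpow_add_le_rpow_add_mul_rpow hα0 hα1 hρ hη0 hη1 (hx k hk) hlarge
      have hxk := hx k hk
      have hmono := Real.rpow_le_rpow (by positivity) (hrec k hk) hb.le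
      push_cast
      linarith
  have hnonneg : 0 ≤ (1 - α) * (1 - η) * ρ * ((k : ℝ) - (kst : ℝ)) + x kst ^ (1 - α) :=
    add_nonneg (mul_nonneg hc (sub_nonneg.mpr (by exact_mod_cast hk)))
      (le_trans (by positivity) hstart)
  have h := Real.rpow_le_rpow hnonneg hmain (one_div_pos.mpr hb).le
  rwa [← Real.rpow_mul (hx k hk).le, mul_one_div_cancel hb.ne', Real.rpow_one] at h
end

section
/- There exists an integer n⋆(ε) such that for all integers n ≥ n⋆(ε) and all integers r ≥ 1, B^n_r ≥ ((2/3)(1−ε)²(r−1) + n^{(2−ε)/3})^{3/(2−ε)}. -/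
noncomputable section

namespace CubePacking

/-- The side lengths `ℓ_k := k^{−(1+ε)/3}`. -/
def sideLen (ε : ℝ) (k : ℕ) : ℝ := (k : ℝ) ^ (-(1 + ε) / 3)

/-- `L_n^m := ∑_{k=n}^m ℓ_k`, the length needed to put the cubes `n,…,m` in a row. -/
def L (ε : ℝ) (n m : ℕ) : ℝ := ∑ k ∈ Finset.Icc n m, sideLen ε k

/-- `M_n := max{m ≥ n : L_n^m ≤ 1} − n + 1`, the number of cubes, starting from the `n`-th,
fitting in a row of length `1`.  (The maximum exists for `n ≥ 1` since `ℓ_n ≤ 1` and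
`L_n^m → ∞` as `m → ∞`; it is realized here by `sSup`, which coincides with the maximum
of a nonempty bounded-above set of naturals.) -/
def M (ε : ℝ) (n : ℕ) : ℕ := sSup {m : ℕ | n ≤ m ∧ L ε n m ≤ 1} - n + 1

/-- The index `B^n_r` of the first cube of the `r`-th row when rows are started at the `n`-th
cube: `B^n_1 := n` and `B^n_{r+1} := B^n_r + M_{B^n_r}` for `r ≥ 1`. -/
def B (ε : ℝ) (n : ℕ) : ℕ → ℕ
  | 0 => n
  | 1 => n
  | r + 2 => B ε n (r + 1) + M ε (B ε n (r + 1))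

/-- `W_n^R := ∑_{r=1}^R (B^n_r)^{−(1+ε)/3}`, the width occupied by `R` rows starting at the
`n`-th cube. -/
def W (ε : ℝ) (n R : ℕ) : ℝ := ∑ r ∈ Finset.Icc 1 R, (B ε n r : ℝ) ^ (-(1 + ε) / 3)

/-- `R_n := max{R ≥ 1 : W_n^R ≤ 1}`, the number of rows fitting in the unit square starting
from the `n`-th cube.  (Again the maximum is realized by `sSup`.) -/
def Rn (ε : ℝ) (n : ℕ) : ℕ := sSup {R : ℕ | 1 ≤ R ∧ W ε n R ≤ 1}

/-- `N_n := B^n_{R_n+1} − n + 1`, the number of cubes in those rows. -/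
def N (ε : ℝ) (n : ℕ) : ℕ := B ε n (Rn ε n + 1) - n + 1

/-- The index `S_l` of the cube starting the `l`-th vertical layer:
`S_1 := 1` and `S_{l+1} := S_l + N_{S_l}` for `l ≥ 1`. -/
def S (ε : ℝ) : ℕ → ℕ
  | 0 => 1
  | 1 => 1
  | l + 2 => S ε (l + 1) + N ε (S ε (l + 1))

/-- The height `H_l := S_l^{−(1+ε)/3}` of the `l`-th layer. -/
def H (ε : ℝ) (l : ℕ) : ℝ := (S ε l : ℝ) ^ (-(1 + ε) / 3)

end CubePacking

namespace CubePacking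

lemma mul_rpow_sub_one_le_rpow_sub_rpow {p : ℝ} (hp0 : 0 ≤ p) (hp1 : p ≤ 1) (k : ℕ) :
    p * ((k + 1 : ℕ) : ℝ) ^ (p - 1) ≤ ((k + 1 : ℕ) : ℝ) ^ p - (k : ℝ) ^ p := by
  have hk : (0 : ℝ) < k + 1 := by positivity
  push_cast
  have hs : (-1 : ℝ) ≤ -(1 / (k + 1)) := by
    rw [neg_le_neg_iff, div_le_one hk]
    linarith [(Nat.cast_nonneg k : (0 : ℝ) ≤ k)]
  have hbern := rpow_one_add_le_one_add_mul_self hs hp0 hp1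
  have hdiv : 1 + -(1 / ((k : ℝ) + 1)) = k / (k + 1) := by
    field_simp
    ring
  rw [hdiv, Real.div_rpow (Nat.cast_nonneg k) hk.le, div_le_iff₀ (by positivity)] at hbern
  rw [Real.rpow_sub_one hk.ne']
  calc p * (((k : ℝ) + 1) ^ p / (k + 1))
      = ((k : ℝ) + 1) ^ p - (1 + p * -(1 / ((k : ℝ) + 1))) * ((k : ℝ) + 1) ^ p := by ring
    _ ≤ _ := by linarith

/-- Comparison of `L_n^m` with the corresponding integral, the first summand being kept apart. -/
lemma mul_L_le {ε : ℝ} (hε1 : -1 ≤ ε) (hε2 : ε ≤ 2) {n m : ℕ} (h : n ≤ m) :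
    (2 - ε) / 3 * L ε n m ≤
      (m : ℝ) ^ ((2 - ε) / 3) - (n : ℝ) ^ ((2 - ε) / 3) + (2 - ε) / 3 * sideLen ε n := by
  induction m, h using Nat.le_induction with
  | base => simp [L]
  | succ m hm ih =>
    have hstep := mul_rpow_sub_one_le_rpow_sub_rpow (p := (2 - ε) / 3)
      (by linarith) (by linarith) m
    rw [show (2 - ε) / 3 - 1 = -(1 + ε) / 3 by ring] at hstep
    have hL : L ε n (m + 1) = L ε n m + sideLen ε (m + 1) :=
      Finset.sum_Icc_succ_top (by omega) _
    rw [hL, mul_add]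
    simp only [sideLen] at *
    linarith

lemma tendsto_L_atTop {ε : ℝ} (hε : ε ≤ 2) (n : ℕ) :
    Filter.Tendsto (L ε n) Filter.atTop Filter.atTop := by
  have hsum : ¬ Summable (sideLen ε) := by
    unfold sideLen
    rw [Real.summable_nat_rpow]
    linarith
  have htend := (not_summable_iff_tendsto_nat_atTop_of_nonneg
    (fun k => Real.rpow_nonneg (Nat.cast_nonneg k) _)).1 hsum
  have hshift := Filter.tendsto_atTop_add_const_right _ (-∑ k ∈ Finset.range n, sideLen ε k)
    (htend.comp (Filter.tendsto_add_atTop_nat 1))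
  refine hshift.congr' ?_
  filter_upwards [Filter.eventually_ge_atTop n] with m hm
  have hIcc : Finset.Icc n m = Finset.Ico n (m + 1) := by
    ext k
    simp only [Finset.mem_Icc, Finset.mem_Ico]
    omega
  rw [L, hIcc, Finset.sum_Ico_eq_sub _ (by omega), sub_eq_add_neg]
  rfl

lemma one_lt_L_add_M {ε : ℝ} (hε1 : -1 ≤ ε) (hε2 : ε ≤ 2) {n : ℕ} (hn : 1 ≤ n) :
    1 < L ε n (n + M ε n) := by
  set s : Set ℕ := {m : ℕ | n ≤ m ∧ L ε n m ≤ 1} with hs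
  have hmem : n ∈ s := by
    refine ⟨le_rfl, ?_⟩
    simp only [L, Finset.Icc_self, Finset.sum_singleton, sideLen]
    exact Real.rpow_le_one_of_one_le_of_nonpos (by exact_mod_cast hn) (by linarith)
  have hbdd : BddAbove s := by
    obtain ⟨a, ha⟩ := Filter.eventually_atTop.1
      ((tendsto_L_atTop hε2 n).eventually_gt_atTop 1)
    refine ⟨a, fun m hm => ?_⟩
    by_contra! hlt
    exact absurd hm.2 (not_le.2 (ha m hlt.le))
  have hle : n ≤ sSup s := le_csSup hbdd hmem
  have hM : n + M ε n = sSup s + 1 := by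
    rw [M, ← hs]
    omega
  rw [hM]
  by_contra! hcon
  have : sSup s + 1 ≤ sSup s := le_csSup hbdd ⟨by omega, hcon⟩
  omega

/-- One row moves the `(2 - ε) / 3`-th power of the index by almost `(2 - ε) / 3`. -/
lemma rpow_add_le_rpow_add_M {ε : ℝ} (hε1 : -1 ≤ ε) (hε2 : ε < 2) {n : ℕ} (hn : 1 ≤ n) :
    (n : ℝ) ^ ((2 - ε) / 3) + (2 - ε) / 3 * (1 - sideLen ε n) ≤
      ((n + M ε n : ℕ) : ℝ) ^ ((2 - ε) / 3) := by
  have hL := mul_L_le hε1 hε2.le (Nat.le_add_right n (M ε n))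
  have hmul := mul_lt_mul_of_pos_left (one_lt_L_add_M hε1 hε2.le hn)
    (show 0 < (2 - ε) / 3 by linarith)
  linarith

lemma tendsto_sideLen {ε : ℝ} (hε : -1 < ε) :
    Filter.Tendsto (sideLen ε) Filter.atTop (nhds 0) := by
  have h := (tendsto_rpow_neg_atTop (show 0 < (1 + ε) / 3 by linarith)).comp
    tendsto_natCast_atTop_atTop
  refine h.congr fun k => ?_
  simp only [sideLen, Function.comp, neg_div]

lemma le_B (ε : ℝ) (n r : ℕ) : n ≤ B ε n (r + 1) := by
  induction r with
  | zero => exact le_rfl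
  | succ r ih => exact ih.trans (Nat.le_add_right _ _)

end CubePacking

open CubePacking in
/-- Lower bound on `B^n_r`.
There exists `n⋆(ε)` such that for all `n ≥ n⋆(ε)` and all `r ≥ 1`,
`B^n_r ≥ ((2/3)(1−ε)²(r−1) + n^{(2−ε)/3})^{3/(2−ε)}`. -/
theorem B_lower_bound (ε : ℝ) (hε0 : 0 < ε) (hε : ε < 1 / 2) :
    ∃ nst : ℕ, ∀ n : ℕ, nst ≤ n → ∀ r : ℕ, 1 ≤ r →
      (2 / 3 * (1 - ε) ^ 2 * ((r : ℝ) - 1) + (n : ℝ) ^ ((2 - ε) / 3)) ^ (3 / (2 - ε))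
        ≤ (B ε n r : ℝ) := by
  have hlim : Filter.Tendsto (fun k => (2 - ε) / 3 * (1 - sideLen ε k)) Filter.atTop
      (nhds ((2 - ε) / 3)) := by
    simpa using ((tendsto_sideLen (by linarith)).const_sub 1).const_mul ((2 - ε) / 3)
  have hlt : 2 / 3 * (1 - ε) ^ 2 < (2 - ε) / 3 := by nlinarith
  obtain ⟨a, ha⟩ := Filter.eventually_atTop.1 (hlim.eventually_const_le hlt)
  refine ⟨a + 1, fun n hn r hr => ?_⟩
  obtain ⟨r, rfl⟩ := Nat.exists_eq_add_of_le' hr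
  rw [show 3 / (2 - ε) = ((2 - ε) / 3)⁻¹ by rw [inv_div]]
  rw [Real.rpow_inv_le_iff_of_pos ?_ (Nat.cast_nonneg _) (by linarith)]
  · clear hr
    induction r with
    | zero => simp [B]
    | succ r ih =>
      have hB := le_B ε n r
      have hrow := rpow_add_le_rpow_add_M (ε := ε) (by linarith) (by linarith)
        (show 1 ≤ B ε n (r + 1) by omega)
      have hstep := ha (B ε n (r + 1)) (by omega)
      have hrec : B ε n (r + 1 + 1) = B ε n (r + 1) + M ε (B ε n (r + 1)) := rfl
      rw [hrec]
      push_cast at ih hrow ⊢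
      linarith
  · push_cast
    rw [add_sub_cancel_right]
    positivity
end
end
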